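/- Suppose f ∈ C^∞(−1,1), 0 < a < b ≤ 1, and ε ∈ (0,1). Then for every n ≥ 1, ‖∫_{−1}^1 f(ξ) log|x−ξ| dξ‖_{C^n[−a,a]} ≤ C(n,a,b,ε) (‖f‖_{C^{n−1+ε}[−b,b]} + ‖f‖_{L^∞[−1,1]}). -/

import Mathlib

open MeasureTheory Set

theorem contDiff_integral_mul_comp_sub {F H : ℝ → ℝ} (hF : LocallyIntegrable F)
    (hc : HasCompactSupport H) (hH : ContDiff ℝ (⊤ : ℕ∞) H) :
    ContDiff ℝ (⊤ : ℕ∞) (fun z => ∫ t, F t * H (z - t)) :=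
  hc.contDiff_convolution_right (ContinuousLinearMap.mul ℝ ℝ) hF hH

theorem hasCompactSupport_iteratedDeriv {H : ℝ → ℝ} (hc : HasCompactSupport H) (k : ℕ) :
    HasCompactSupport (iteratedDeriv k H) := by
  induction k with
  | zero => simpa using hc
  | succ k ih => rw [iteratedDeriv_succ]; exact ih.deriv

theorem contDiff_iteratedDeriv {H : ℝ → ℝ} (hH : ContDiff ℝ (⊤ : ℕ∞) H) (k : ℕ) :
    ContDiff ℝ (⊤ : ℕ∞) (iteratedDeriv k H) := by
  induction k with
  | zero => simpa using hH
  | succ k ih => rw [iteratedDeriv_succ]; exact (contDiff_infty_iff_deriv.1 ih).2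

theorem iteratedDeriv_integral_mul_comp_sub {F H : ℝ → ℝ} (hF : LocallyIntegrable F)
    (hc : HasCompactSupport H) (hH : ContDiff ℝ (⊤ : ℕ∞) H) (k : ℕ) :
    iteratedDeriv k (fun z => ∫ t, F t * H (z - t)) =
      fun z => ∫ t, F t * iteratedDeriv k H (z - t) := by
  induction k with
  | zero => simp
  | succ k ih =>
    rw [iteratedDeriv_succ, ih]
    ext z
    rw [iteratedDeriv_succ]
    exact ((hasCompactSupport_iteratedDeriv hc k).hasDerivAt_convolution_right
      (ContinuousLinearMap.mul ℝ ℝ) hF ((contDiff_iteratedDeriv hH k).of_le (by simp)) z).deriv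

theorem intervalIntegrable_abs_rpow {r : ℝ} (hr : -1 < r) (a b : ℝ) :
    IntervalIntegrable (fun t : ℝ => |t| ^ r) volume a b := by
  apply intervalIntegrable_of_even (fun x => by rw [abs_neg])
  intro x hx
  refine (intervalIntegral.intervalIntegrable_rpow' (r := r) hr).congr ?_
  intro t ht
  rw [uIoc_of_le hx.le] at ht
  simp only [abs_of_pos ht.1]

/-- Integration by parts for a truncated logarithmic kernel: the integral against a derivative is
controlled by the Hölder seminorm of the primitive. -/
theorem abs_integral_log_mul_deriv_le {φ h : ℝ → ℝ} {δ ε M x : ℝ} (hδ : 0 < δ) (hε : 0 < ε)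
    (hφ : ContDiff ℝ (⊤ : ℕ∞) φ) (hφ0 : ∀ t, δ ≤ |t| → φ t = 0) (hh : ContDiff ℝ (⊤ : ℕ∞) h)
    (hM : ∀ t, |t| ≤ δ → |h x - h (x - t)| ≤ M * |t| ^ ε) :
    |∫ t, φ t * Real.log t * deriv h (x - t)| ≤
      M * ∫ t in (-δ)..δ, (|t| ^ ε * |deriv φ t| * |Real.log t| + |φ t| * |t| ^ (ε - 1)) := by
  have hlog : ∀ u : ℝ → ℝ, Continuous u →
      IntervalIntegrable (fun t => u t * Real.log t) volume (-δ) δ := fun u hu =>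
    intervalIntegral.intervalIntegrable_log'.continuousOn_mul hu.continuousOn
  have hφ' : Continuous (deriv φ) := hφ.continuous_deriv (by simp)
  have hh' : Continuous (deriv h) := hh.continuous_deriv (by simp)
  have hhd : Differentiable ℝ h := hh.differentiable (by simp)
  have hφd : Differentiable ℝ φ := hφ.differentiable (by simp)
  set q : ℝ → ℝ := fun t => h x - h (x - t) with hq
  have hqd : ∀ t, HasDerivAt q (deriv h (x - t)) t := fun t => by
    simpa using ((hhd (x - t)).hasDerivAt.comp_const_sub x t).const_sub (h x)
  have hqc : Continuous q := continuous_iff_continuousAt.2 fun t => (hqd t).continuousAt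
  set s : ℝ → ℝ := dslope q 0 with hs
  have hsc : Continuous s := by
    rw [← continuousOn_univ]
    exact (continuousOn_dslope Filter.univ_mem).2 ⟨hqc.continuousOn, (hqd 0).differentiableAt⟩
  have hqs : ∀ t, q t = t * s t := fun t => by
    have := sub_smul_dslope q 0 t
    simp only [sub_zero, smul_eq_mul] at this
    rw [hs, this]; simp [hq]
  set R : ℝ → ℝ := fun t => q t * deriv φ t * Real.log t + φ t * s t with hR
  have hRi : IntervalIntegrable R volume (-δ) δ :=
    (hlog _ (hqc.mul hφ')).add ((hφ.continuous.mul hsc).intervalIntegrable _ _)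
  have hTi : IntervalIntegrable (fun t => φ t * Real.log t * deriv h (x - t)) volume (-δ) δ := by
    refine (hlog (fun t => φ t * deriv h (x - t)) (by fun_prop)).congr ?_
    intro t _
    ring
  have key : ∫ t in (-δ)..δ, (φ t * Real.log t * deriv h (x - t) + R t) = 0 := by
    rw [integral_eq_of_hasDerivAt_off_countable (fun t => φ t * s t * (t * Real.log t)) _
      (s := {0}) (countable_singleton 0) _ _ (hTi.add hRi)]
    · simp [hφ0 δ (le_abs_self δ), hφ0 (-δ) (by rw [abs_neg]; exact le_abs_self δ)]
    · exact ((hφ.continuous.mul hsc).mul Real.continuous_mul_log).continuousOn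
    · intro t ht
      have ht0 : t ≠ 0 := ht.2
      have h1 := ((hφd t).hasDerivAt.mul (hqd t)).mul (Real.hasDerivAt_log ht0)
      have h2 : (fun t => φ t * s t * (t * Real.log t)) = φ * q * Real.log := by
        ext t; simp only [Pi.mul_apply, hqs]; ring
      rw [h2]
      refine h1.congr_deriv ?_
      simp only [hR, hqs, Pi.mul_apply]
      field_simp
      ring
  rw [intervalIntegral.integral_add hTi hRi] at key
  have hsupp : ∫ t in (-δ)..δ, φ t * Real.log t * deriv h (x - t) =
      ∫ t, φ t * Real.log t * deriv h (x - t) := by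
    apply intervalIntegral.integral_eq_integral_of_support_subset
    intro t ht
    by_contra hcon
    refine ht ?_
    have : δ ≤ |t| := by
      by_contra! hlt
      exact hcon ⟨(abs_lt.1 hlt).1, (abs_lt.1 hlt).2.le⟩
    simp [hφ0 t this]
  rw [← hsupp, show ∫ t in (-δ)..δ, φ t * Real.log t * deriv h (x - t) =
    -∫ t in (-δ)..δ, R t by linarith, abs_neg, ← intervalIntegral.integral_const_mul]
  have hWi : IntervalIntegrable (fun t => M * (|t| ^ ε * |deriv φ t| * |Real.log t| +
      |φ t| * |t| ^ (ε - 1))) volume (-δ) δ := by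
    refine (IntervalIntegrable.add ?_ ?_).const_mul M
    · exact intervalIntegral.intervalIntegrable_log'.abs.continuousOn_mul
        ((continuous_abs.rpow_const fun _ => Or.inr hε.le).mul hφ'.abs).continuousOn
    · exact (intervalIntegrable_abs_rpow (by linarith) _ _).continuousOn_mul
        hφ.continuous.abs.continuousOn
  rw [← Real.norm_eq_abs]
  refine intervalIntegral.norm_integral_le_of_norm_le (by linarith) ?_ hWi
  have h0 : ∀ᵐ t : ℝ, t ≠ 0 := by simp [ae_iff]
  filter_upwards [h0] with t ht0 ht
  have hpos : 0 < |t| := abs_pos.2 ht0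
  have hqt : |q t| ≤ M * |t| ^ ε := hM t (abs_le.2 ⟨ht.1.le, ht.2⟩)
  have hst : |s t| ≤ M * |t| ^ (ε - 1) := by
    rw [Real.rpow_sub_one hpos.ne', ← mul_div_assoc, le_div_iff₀ hpos, mul_comm, ← abs_mul,
      ← hqs]
    exact hqt
  calc ‖R t‖ ≤ |q t| * |deriv φ t| * |Real.log t| + |φ t| * |s t| := by
        rw [Real.norm_eq_abs, ← abs_mul, ← abs_mul, ← abs_mul]
        exact abs_add_le _ _
    _ ≤ M * |t| ^ ε * |deriv φ t| * |Real.log t| + |φ t| * (M * |t| ^ (ε - 1)) := by gcongr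
    _ = _ := by ring

theorem locallyIntegrable_mul_log {u : ℝ → ℝ} (hu : Continuous u) :
    LocallyIntegrable (fun t => u t * Real.log t) := by
  intro x
  refine ⟨Ioc (x - 1) (x + 1), Ioc_mem_nhds (by linarith) (by linarith), ?_⟩
  exact (intervalIntegrable_iff_integrableOn_Ioc_of_le (by linarith)).1
    (intervalIntegral.intervalIntegrable_log'.continuousOn_mul hu.continuousOn)

theorem contDiff_mul_log {u : ℝ → ℝ} (hu : ContDiff ℝ (⊤ : ℕ∞) u)
    (h0 : u =ᶠ[nhds 0] 0) : ContDiff ℝ (⊤ : ℕ∞) (fun t => u t * Real.log t) := by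
  rw [contDiff_iff_contDiffAt]
  intro t
  by_cases ht : t = 0
  · subst ht
    refine (contDiffAt_const (c := (0 : ℝ))).congr_of_eventuallyEq ?_
    filter_upwards [h0] with s hs
    simp [hs]
  · exact hu.contDiffAt.mul (Real.contDiffAt_log.2 ht)

/-- A compactly supported smooth function agreeing with `f` on a smaller interval. -/
theorem exists_contDiff_extension {f : ℝ → ℝ} (hf : ContDiffOn ℝ (⊤ : ℕ∞) f (Set.Ioo (-1) 1))
    {r : ℝ} (hr0 : 0 < r) (hr : r < 1) :
    ∃ g : ℝ → ℝ, ContDiff ℝ (⊤ : ℕ∞) g ∧ HasCompactSupport g ∧ (∀ y, |y| ≤ r → g y = f y) ∧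
      ∀ y, 1 ≤ |y| → g y = 0 := by
  let χ : ContDiffBump (0 : ℝ) := ⟨r, (r + 1) / 2, hr0, by linarith⟩
  have hχ0 : ∀ y, (r + 1) / 2 ≤ |y| → χ y = 0 := fun y hy =>
    χ.zero_of_le_dist (by rwa [Real.dist_0_eq_abs])
  refine ⟨fun y => χ y * f y, ?_, χ.hasCompactSupport.mul_right, fun y hy => ?_, fun y hy => ?_⟩
  · rw [contDiff_iff_contDiffAt]
    intro y
    by_cases hy : y ∈ Set.Ioo (-1 : ℝ) 1
    · exact χ.contDiff.contDiffAt.mul (hf.contDiffAt (isOpen_Ioo.mem_nhds hy))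
    · refine (contDiffAt_const (c := (0 : ℝ))).congr_of_eventuallyEq ?_
      have hy' : (r + 1) / 2 < |y| := by
        by_contra! hlt
        exact hy (abs_lt.1 (by linarith))
      filter_upwards [continuous_abs.continuousAt.eventually (lt_mem_nhds hy')] with z hz
      simp [hχ0 z hz.le]
  · simp [χ.one_of_mem_closedBall (x := y) (by simpa using hy)]
  · simp [hχ0 y (by linarith)]

/-- Near a point of `(-a - δ, a + δ)` the logarithmic potential splits into the potential of the
singular truncated kernel and that of a smooth kernel. -/
theorem integral_mul_log_eq_add {f g φ ψ : ℝ → ℝ} {r δ z : ℝ} (hr : r < 1)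
    (hf : IntegrableOn f (Ioo (-1) 1))
    (hg : ContDiff ℝ (⊤ : ℕ∞) g) (hgc : HasCompactSupport g) (hgf : ∀ y, |y| ≤ r → g y = f y)
    (hg0 : ∀ y, 1 ≤ |y| → g y = 0) (hφ : Continuous φ) (hφ0 : ∀ t, δ ≤ |t| → φ t = 0)
    (hψ : ∀ t, |t| ≤ 2 → ψ t = 1)
    (hK : Continuous fun t => (ψ t - φ t) * Real.log t)
    (hKc : HasCompactSupport fun t => (ψ t - φ t) * Real.log t) (hδ : 0 < δ) (hz : |z| + δ ≤ r) :
    ∫ ξ in (-1 : ℝ)..1, f ξ * Real.log |z - ξ| =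
      (∫ t, φ t * Real.log t * g (z - t)) +
        ∫ ξ, (Ioo (-1 : ℝ) 1).indicator f ξ * ((ψ (z - ξ) - φ (z - ξ)) * Real.log (z - ξ)) := by
  have hF : Integrable ((Ioo (-1 : ℝ) 1).indicator f) :=
    (integrable_indicator_iff measurableSet_Ioo).2 hf
  have h1 : Integrable fun t => φ t * Real.log t * g (z - t) :=
    (hgc.convolutionExists_right (ContinuousLinearMap.mul ℝ ℝ) (locallyIntegrable_mul_log hφ)
      hg.continuous z).integrable
  have h2 : Integrable fun ξ => (Ioo (-1 : ℝ) 1).indicator f ξ *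
      ((ψ (z - ξ) - φ (z - ξ)) * Real.log (z - ξ)) :=
    (hKc.convolutionExists_right (ContinuousLinearMap.mul ℝ ℝ) hF.locallyIntegrable
      hK z).integrable
  rw [← integral_sub_left_eq_self (fun t => φ t * Real.log t * g (z - t)) volume z,
    ← integral_add (h1.comp_sub_left z) h2,
    intervalIntegral.integral_of_le (by norm_num), integral_Ioc_eq_integral_Ioo,
    ← integral_indicator measurableSet_Ioo]
  congr 1
  ext ξ
  rw [sub_sub_cancel]
  by_cases hξ : ξ ∈ Ioo (-1 : ℝ) 1
  · simp only [indicator_of_mem hξ, Real.log_abs]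
    have hz' := abs_le.1 (show |z| ≤ r - δ by linarith)
    rw [hψ (z - ξ) (abs_le.2 ⟨by linarith [hξ.2, hz'.1], by linarith [hξ.1, hz'.2]⟩)]
    by_cases hd : δ ≤ |z - ξ|
    · rw [hφ0 _ hd]; ring
    · have hd' := abs_lt.1 (not_le.1 hd)
      rw [hgf ξ (abs_le.2 ⟨by linarith [hz'.1, hd'.2], by linarith [hz'.2, hd'.1]⟩)]
      ring
  · have : 1 ≤ |ξ| := by
      by_contra! hlt
      exact hξ (abs_lt.1 hlt)
    simp [indicator_of_notMem hξ, hg0 ξ this]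

/-- The logarithmic potential estimate: for f ∈ C^∞(−1,1), 0 < a < b ≤ 1, ε ∈ (0,1), n ≥ 1,
‖∫ f(ξ) log|x−ξ| dξ‖_{C^n[−a,a]} ≤ C(n,a,b,ε)(‖f‖_{C^{n−1+ε}[−b,b]} + ‖f‖_{L^∞[−1,1]}). -/
theorem stmt19 : ∀ (n : ℕ), 1 ≤ n → ∀ a b ε : ℝ, 0 < a → a < b → b ≤ 1 →
    ε ∈ Set.Ioo (0:ℝ) 1 →
    ∃ C : ℝ, 0 < C ∧ ∀ (f : ℝ → ℝ) (M M' : ℝ),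
      ContDiffOn ℝ (⊤ : ℕ∞) f (Set.Ioo (-1:ℝ) 1) →
      (∀ k ≤ n - 1, ∀ x ∈ Set.Icc (-b) b,
        |iteratedDerivWithin k f (Set.Ioo (-1:ℝ) 1) x| ≤ M) →
      (∀ x ∈ Set.Icc (-b) b, ∀ y ∈ Set.Icc (-b) b,
        |iteratedDerivWithin (n - 1) f (Set.Ioo (-1:ℝ) 1) x -
          iteratedDerivWithin (n - 1) f (Set.Ioo (-1:ℝ) 1) y| ≤ M * |x - y| ^ ε) →
      (∀ x ∈ Set.Icc (-1:ℝ) 1, |f x| ≤ M') →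
      ∀ k ≤ n, ∀ x ∈ Set.Icc (-a) a,
        |iteratedDeriv k (fun z => ∫ ξ in (-1:ℝ)..1, f ξ * Real.log |z - ξ|) x|
          ≤ C * (M + M') := by
  intro n hn a b ε ha hab hb hε
  obtain ⟨m, rfl⟩ : ∃ m, n = m + 1 := ⟨n - 1, by omega⟩
  rw [Nat.add_sub_cancel]
  set δ : ℝ := (b - a) / 4 with hδdef
  have hδ : 0 < δ := by linarith
  let φ : ContDiffBump (0 : ℝ) := ⟨δ / 2, δ, by linarith, by linarith⟩
  let ψ : ContDiffBump (0 : ℝ) := ⟨2, 3, by norm_num, by norm_num⟩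
  have hφ : ContDiff ℝ (⊤ : ℕ∞) φ := φ.contDiff
  have hφ0 : ∀ t, δ ≤ |t| → φ t = 0 := fun t ht =>
    φ.zero_of_le_dist (by rwa [Real.dist_0_eq_abs])
  have hψ1 : ∀ t, |t| ≤ 2 → ψ t = 1 := fun t ht => ψ.one_of_mem_closedBall (by simpa using ht)
  set L : ℝ → ℝ := fun t => φ t * Real.log t with hL
  set K : ℝ → ℝ := fun t => (ψ t - φ t) * Real.log t with hK
  have hLl : LocallyIntegrable L := locallyIntegrable_mul_log φ.continuous
  have hLc : HasCompactSupport L := φ.hasCompactSupport.mul_right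
  have hLi : Integrable L :=
    (integrableOn_iff_integrable_of_support_subset (subset_tsupport L)).1
      (hLl.integrableOn_isCompact hLc)
  have hKs : ContDiff ℝ (⊤ : ℕ∞) K := by
    refine contDiff_mul_log (ψ.contDiff.sub hφ) ?_
    filter_upwards [φ.eventuallyEq_one, ψ.eventuallyEq_one] with t h1 h2
    simp [h1, h2]
  have hKc : HasCompactSupport K := (ψ.hasCompactSupport.sub φ.hasCompactSupport).mul_right
  have hB : ∀ k, ∃ B, ∀ t, ‖iteratedDeriv k K t‖ ≤ B := fun k =>
    (hasCompactSupport_iteratedDeriv hKc k).exists_bound_of_continuous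
      (contDiff_iteratedDeriv hKs k).continuous
  choose B hB using hB
  have hB0 : ∀ k, 0 ≤ B k := fun k => (norm_nonneg _).trans (hB k 0)
  set C₁ : ℝ := ∫ t, |L t| with hC₁
  set C₂ : ℝ := ∫ t in (-δ)..δ, (|t| ^ ε * |deriv φ t| * |Real.log t| + |φ t| * |t| ^ (ε - 1))
    with hC₂
  set S : ℝ := ∑ k ∈ Finset.range (m + 2), B k with hS
  have hC₁0 : 0 ≤ C₁ := integral_nonneg fun t => abs_nonneg _
  have hC₂0 : 0 ≤ C₂ := intervalIntegral.integral_nonneg (by linarith) fun t _ => by positivity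
  have hS0 : 0 ≤ S := Finset.sum_nonneg fun k _ => hB0 k
  refine ⟨C₁ + C₂ + 2 * S + 1, by linarith, fun f M M' hf hM hHol hM' k hk x hx => ?_⟩
  have hM0 : 0 ≤ M := (abs_nonneg _).trans (hM 0 (Nat.zero_le _) 0 ⟨by linarith, by linarith⟩)
  have hM'0 : 0 ≤ M' := (abs_nonneg _).trans (hM' 0 (by norm_num))
  have hxa : |x| ≤ a := abs_le.2 hx
  have hfi : IntegrableOn f (Ioo (-1) 1) := by
    refine Integrable.of_bound (hf.continuousOn.aestronglyMeasurable measurableSet_Ioo) M' ?_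
    filter_upwards [ae_restrict_mem measurableSet_Ioo] with t ht
    exact hM' t (Ioo_subset_Icc_self ht)
  set F : ℝ → ℝ := (Ioo (-1 : ℝ) 1).indicator f with hF
  have hFi : Integrable F := (integrable_indicator_iff measurableSet_Ioo).2 hfi
  obtain ⟨g, hg, hgc, hgf, hg0⟩ :=
    exists_contDiff_extension hf (r := a + 2 * δ) (by linarith) (by linarith)
  have hgk : ∀ j y, |y| < a + 2 * δ →
      iteratedDeriv j g y = iteratedDerivWithin j f (Ioo (-1 : ℝ) 1) y := by
    intro j y hy
    rw [iteratedDerivWithin_of_isOpen isOpen_Ioo (abs_lt.1 (by linarith))]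
    apply Filter.EventuallyEq.iteratedDeriv_eq
    filter_upwards [continuous_abs.continuousAt.eventually (gt_mem_nhds hy)] with z hz
    exact hgf z hz.le
  have hxt : ∀ t, |t| ≤ δ → |x - t| < a + 2 * δ := fun t ht => by
    linarith [abs_sub x t]
  have hmem : ∀ y, |y| < a + 2 * δ → y ∈ Icc (-b) b := fun y hy => abs_le.1 (by linarith)
  have hsplit : (fun z => ∫ ξ in (-1 : ℝ)..1, f ξ * Real.log |z - ξ|) =ᶠ[nhds x]
      fun z => (∫ t, L t * g (z - t)) + ∫ ξ, F ξ * K (z - ξ) := by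
    filter_upwards [continuous_abs.continuousAt.eventually
      (gt_mem_nhds (show |x| < a + δ by linarith))] with z hz
    exact integral_mul_log_eq_add (by linarith) hfi hg hgc hgf hg0 φ.continuous hφ0 hψ1
      hKs.continuous hKc hδ (by linarith)
  rw [hsplit.iteratedDeriv_eq, iteratedDeriv_fun_add
    (((contDiff_integral_mul_comp_sub hLl hgc hg).of_le (by exact_mod_cast le_top)).contDiffAt)
    (((contDiff_integral_mul_comp_sub hFi.locallyIntegrable hKc hKs).of_le
      (by exact_mod_cast le_top)).contDiffAt),
    iteratedDeriv_integral_mul_comp_sub hLl hgc hg,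
    iteratedDeriv_integral_mul_comp_sub hFi.locallyIntegrable hKc hKs]
  have hsmooth : |∫ t, F t * iteratedDeriv k K (x - t)| ≤ 2 * S * M' := by
    have hBS : B k ≤ S :=
      Finset.single_le_sum (fun j _ => hB0 j) (Finset.mem_range.2 (by omega))
    have hind : ∀ t, F t * iteratedDeriv k K (x - t) =
        (Ioo (-1 : ℝ) 1).indicator (fun t => f t * iteratedDeriv k K (x - t)) t := fun t => by
      by_cases ht : t ∈ Ioo (-1 : ℝ) 1 <;> simp [hF, ht]
    simp_rw [hind]
    rw [integral_indicator measurableSet_Ioo, ← Real.norm_eq_abs]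
    refine (norm_setIntegral_le_of_norm_le_const (C := M' * S) (by simp) fun t ht => ?_).trans
      (le_of_eq ?_)
    · rw [norm_mul]
      exact mul_le_mul (hM' t (Ioo_subset_Icc_self ht)) ((hB k _).trans hBS) (norm_nonneg _) hM'0
    · rw [Real.volume_real_Ioo_of_le (by norm_num)]
      ring
  have hsing : |∫ t, L t * iteratedDeriv k g (x - t)| ≤ (C₁ + C₂) * M := by
    rcases hk.lt_or_eq with hk | rfl
    · have h1 : |∫ t, L t * iteratedDeriv k g (x - t)| ≤ ∫ t, |L t| * M := by
        rw [← Real.norm_eq_abs]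
        refine norm_integral_le_of_norm_le (hLi.abs.mul_const M) (.of_forall fun t => ?_)
        rw [norm_mul, Real.norm_eq_abs, Real.norm_eq_abs]
        by_cases ht : δ ≤ |t|
        · simp [hL, hφ0 t ht]
        · have := hxt t (not_le.1 ht).le
          rw [hgk k _ this]
          exact mul_le_mul_of_nonneg_left (hM k (by omega) _ (hmem _ this)) (abs_nonneg _)
      rw [integral_mul_const] at h1
      nlinarith
    · have h1 := abs_integral_log_mul_deriv_le (x := x) (M := M) hδ hε.1 hφ hφ0
        (contDiff_iteratedDeriv hg m) fun t ht => by
          have hx' : |x| < a + 2 * δ := by linarith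
          rw [hgk m _ (hxt t ht), hgk m _ hx']
          simpa using hHol x (hmem _ hx') (x - t) (hmem _ (hxt t ht))
      rw [iteratedDeriv_succ]
      refine h1.trans ?_
      nlinarith
  refine (abs_add_le _ _).trans ((add_le_add hsing hsmooth).trans ?_)
  nlinarith [mul_nonneg hC₁0 hM'0, mul_nonneg hC₂0 hM'0, mul_nonneg hS0 hM0]
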